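/- Let X be a bifurcating Markov chain with kernel P started at X_∅ = x. For every bounded measurable f : S → ℝ, every x ∈ S and every n ≥ 0: (a) E_x[M_{G_n}(f)] = 2^n (Q^n f)(x); and (b) E_x[M_{G_n}(f)²] = 2^n Q^n(f²)(x) + Σ_{k=0}^{n−1} 2^{n+k} Q^{n−k−1}( P( Q^k f ⊗ Q^k f ) )(x), where (g⊗g')(y,z) = g(y)g'(z). -/

import Mathlib

open MeasureTheory Filter ProbabilityTheory

noncomputable section

namespace BMC

/-- A vertex of the infinite binary tree is a finite word over `{0,1}`. -/
abbrev Word : Type := List Bool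

/-- The `k`-th generation `G_k` of the binary tree. -/
def gen (k : ℕ) : Finset Word :=
  (Finset.univ : Finset (Fin k → Bool)).image fun f => List.ofFn f

/-- The tree `T_k` up to generation `k`. -/
def tree (k : ℕ) : Finset Word := (Finset.range (k + 1)).biUnion gen

/-- The (lexicographic-genealogic) order on the binary tree: `i ≤ j` iff `i` is an
ancestor of `j`, or `v0` is an ancestor of `i` and `v1` an ancestor of `j` for some `v`. -/
def wle (i j : Word) : Prop :=
  i <+: j ∨ ∃ v : Word, (v ++ [false]) <+: i ∧ (v ++ [true]) <+: j

variable {d : ℕ}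

/-- Euclidean norm on `Fin d → ℝ`. -/
def enorm (x : Fin d → ℝ) : ℝ := Real.sqrt (∑ j, x j ^ 2)

/-- Action of the kernel `P` on a function of the pair of children. -/
def Pop (P : Kernel (Fin d → ℝ) ((Fin d → ℝ) × (Fin d → ℝ)))
    (h : (Fin d → ℝ) × (Fin d → ℝ) → ℝ) (x : Fin d → ℝ) : ℝ := ∫ p, h p ∂(P x)

/-- The mean kernel `Q = (P₀ + P₁)/2`, acting on functions. -/
def Qop (P : Kernel (Fin d → ℝ) ((Fin d → ℝ) × (Fin d → ℝ)))
    (f : (Fin d → ℝ) → ℝ) : (Fin d → ℝ) → ℝ :=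
  fun x => (∫ p, (f p.1 + f p.2) ∂(P x)) / 2

/-- The σ-field generated by the chain up to generation `k`. -/
def sigmaUpTo {Ω : Type*} [MeasurableSpace Ω] (X : Word → Ω → (Fin d → ℝ)) (k : ℕ) :
    MeasurableSpace Ω :=
  ⨆ j ∈ tree k, MeasurableSpace.comap (X j) inferInstance

/-- The σ-field `F_i` generated by `X_u` for `u ≤ i` in the tree order. -/
def Fsig {Ω : Type*} [MeasurableSpace Ω] (X : Word → Ω → (Fin d → ℝ)) (i : Word) :
    MeasurableSpace Ω :=
  ⨆ u ∈ {u : Word | wle u i}, MeasurableSpace.comap (X u) inferInstance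

/-- `X` is a bifurcating Markov chain with initial distribution `ν` and kernel `P`. -/
structure IsBMC {Ω : Type*} [MeasurableSpace Ω] (Pr : Measure Ω)
    (X : Word → Ω → (Fin d → ℝ)) (ν : Measure (Fin d → ℝ))
    (P : Kernel (Fin d → ℝ) ((Fin d → ℝ) × (Fin d → ℝ))) : Prop where
  meas : ∀ i, Measurable (X i)
  init : Pr.map (X []) = ν
  branching : ∀ (k : ℕ) (g : Word → (Fin d → ℝ) → (Fin d → ℝ) → (Fin d → ℝ) → ℝ),
    (∀ i, Measurable fun p : (Fin d → ℝ) × (Fin d → ℝ) × (Fin d → ℝ) => g i p.1 p.2.1 p.2.2) →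
    (∀ i, ∃ C, ∀ x y z, |g i x y z| ≤ C) →
    (Pr[(fun ω => ∏ i ∈ gen k, g i (X i ω) (X (i ++ [false]) ω) (X (i ++ [true]) ω))
        | sigmaUpTo X k]
      =ᵐ[Pr] fun ω => ∏ i ∈ gen k, ∫ p, g i (X i ω) p.1 p.2 ∂(P (X i ω)))

/-- Uniform geometric ergodicity of `Q` with invariant measure `μm`, rate `α`, constant `M`. -/
def ErgodicQ (P : Kernel (Fin d → ℝ) ((Fin d → ℝ) × (Fin d → ℝ)))
    (μm : Measure (Fin d → ℝ)) (M α : ℝ) : Prop :=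
  ∀ (f : (Fin d → ℝ) → ℝ) (C : ℝ), Measurable f → (∀ x, |f x| ≤ C) →
    ∀ (n : ℕ) (x : Fin d → ℝ), |(Qop P)^[n] f x - ∫ y, f y ∂μm| ≤ M * α ^ n * C

/-- `μm` is invariant for `Q`. -/
def IsInvariantQ (P : Kernel (Fin d → ℝ) ((Fin d → ℝ) × (Fin d → ℝ)))
    (μm : Measure (Fin d → ℝ)) : Prop :=
  ∀ f : (Fin d → ℝ) → ℝ, Measurable f → (∃ C, ∀ x, |f x| ≤ C) →
    ∫ x, Qop P f x ∂μm = ∫ x, f x ∂μm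

/-- The bandwidth `h_n = 2^{-nγ}`. -/
def bandwidth (γ : ℝ) (n : ℕ) : ℝ := (2 : ℝ) ^ (-(n : ℝ) * γ)

/-- The kernel density estimator `μ̂_{A}(x)` built from observations indexed by `A`. -/
def est {Ω : Type*} (K : (Fin d → ℝ) → ℝ) (X : Word → Ω → (Fin d → ℝ)) (γ : ℝ)
    (A : Finset Word) (n : ℕ) (x : Fin d → ℝ) (ω : Ω) : ℝ :=
  (A.card : ℝ)⁻¹ * (bandwidth γ n ^ (d : ℝ))⁻¹ *
    ∑ u ∈ A, K ((bandwidth γ n)⁻¹ • (x - X u ω))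

/-- One-dimensional `k`-th partial derivative of `f` in direction `j` at `x`. -/
def pder (f : (Fin d → ℝ) → ℝ) (j : Fin d) (k : ℕ) (x : Fin d → ℝ) : ℝ :=
  iteratedDeriv k (fun t => f (Function.update x j t)) (x j)

/-- `f` belongs to the isotropic Hölder class of order `s` with constant `L`. -/
def HolderClass (f : (Fin d → ℝ) → ℝ) (s L : ℝ) : Prop :=
  (∀ (j : Fin d) (x : Fin d → ℝ),
      ContDiff ℝ (⌊s⌋₊ : ℕ∞) fun t => f (Function.update x j t)) ∧
  ∀ (j : Fin d) (x : Fin d → ℝ) (t : ℝ),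
    |pder f j ⌊s⌋₊ (Function.update x j t) - pder f j ⌊s⌋₊ x| ≤
      L * |x j - t| ^ (s - (⌊s⌋₊ : ℝ))

/-- Regularity of the kernel function `K`. -/
def KernelReg (K : (Fin d → ℝ) → ℝ) : Prop :=
  Measurable K ∧ (∃ C, ∀ x, |K x| ≤ C) ∧ Integrable K volume ∧
    Integrable (fun x => K x ^ 2) volume ∧ (∫ x, K x) = 1 ∧
    ∀ ε > 0, ∃ R, ∀ x, R ≤ enorm x → |enorm x * K x| < ε

/-- `K` is of order `⌊s⌋`. -/
def KernelOrder (K : (Fin d → ℝ) → ℝ) (s : ℝ) : Prop :=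
  Integrable (fun x => enorm x ^ s * |K x|) volume ∧
    ∀ (j : Fin d) (k : ℕ), 1 ≤ k → k ≤ ⌊s⌋₊ →
      ∀ x : Fin d → ℝ, (∫ t : ℝ, t ^ k * K (Function.update x j t)) = 0

/-- Conditions (2.7) on the moderate deviation speed `b_n`. -/
def SpeedCond (b : ℕ → ℝ) (γ s : ℝ) (d : ℕ) : Prop :=
  (∀ n, 0 < b n) ∧ Tendsto b atTop atTop ∧
    Tendsto (fun n : ℕ => (n : ℝ) ^ (3 / 2 : ℝ) * b n /
      Real.sqrt (2 ^ n * bandwidth γ n ^ (d : ℝ))) atTop (nhds 0) ∧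
    Tendsto (fun n => b n /
      Real.sqrt (2 ^ n * bandwidth γ n ^ (2 * s + d))) atTop atTop

/-- `W` satisfies a moderate deviation principle with speed `b_n²` and rate function `I`. -/
def MDPseq {E Ω : Type*} [TopologicalSpace E] [MeasurableSpace E] [MeasurableSpace Ω]
    (Pr : Measure Ω) (W : ℕ → Ω → E) (b : ℕ → ℝ) (I : E → ℝ) : Prop :=
  ∀ A : Set E, MeasurableSet A →
    (-(⨅ y ∈ interior A, (I y : EReal)) ≤
      Filter.liminf
        (fun n => (((b n ^ 2)⁻¹ : ℝ) : EReal) * ENNReal.log (Pr {ω | W n ω ∈ A})) atTop) ∧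
    Filter.limsup
        (fun n => (((b n ^ 2)⁻¹ : ℝ) : EReal) * ENNReal.log (Pr {ω | W n ω ∈ A})) atTop ≤
      -(⨅ y ∈ closure A, (I y : EReal))

/-- `f` centered with respect to `μm`. -/
def tilde (μm : Measure (Fin d → ℝ)) (f : (Fin d → ℝ) → ℝ) (x : Fin d → ℝ) : ℝ :=
  f x - ∫ y, f y ∂μm

/-- `M_A(f) = Σ_{i ∈ A} f(X_i)`. -/
def MA {Ω : Type*} (X : Word → Ω → (Fin d → ℝ)) (A : Finset Word)
    (f : (Fin d → ℝ) → ℝ) (ω : Ω) : ℝ :=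
  ∑ i ∈ A, f (X i ω)

/-- Assumption 2.4 on the sequence of functions `𝔣_n = (f_{ℓ,n})`, where `f n ℓ = f_{ℓ,n}`. -/
def FnAssump (P : Kernel (Fin d → ℝ) ((Fin d → ℝ) × (Fin d → ℝ)))
    (μm : Measure (Fin d → ℝ)) (γ : ℝ) (f : ℕ → ℕ → (Fin d → ℝ) → ℝ) (σ2 : ℝ) : Prop :=
  (∀ n ℓ, Measurable (f n ℓ)) ∧
  (∀ n ℓ, n < ℓ → f n ℓ = 0) ∧
  (∃ C : ℝ, ∀ n : ℕ, ∀ ℓ ≤ n,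
    (∀ x, bandwidth γ n ^ ((d : ℝ) / 2) * |f n ℓ x| ≤ C) ∧
    (∀ x, |Qop P (f n ℓ) x| ≤ C * bandwidth γ n ^ ((d : ℝ) / 2)) ∧
    (∀ x, |Qop P (fun y => f n ℓ y ^ 2) x| ≤ C) ∧
    (∀ x, |Pop P (fun q => f n ℓ q.1 * f n ℓ q.2) x| ≤ C * bandwidth γ n ^ (d : ℝ))) ∧
  (∃ C : ℝ, ∀ n : ℕ, ∀ ℓ ≤ n,
    (∫ x, |f n ℓ x| ∂μm) ≤ C * bandwidth γ n ^ ((d : ℝ) / 2) ∧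
    (∫ x, f n ℓ x ^ 2 ∂μm) ≤ C) ∧
  Tendsto (fun n => ∑ ℓ ∈ Finset.range (n + 1), ((2 : ℝ)⁻¹) ^ ℓ * ∫ x, f n ℓ x ^ 2 ∂μm)
    atTop (nhds σ2)

/-- `N_{n,∅}(𝔣_n)`. -/
def Nempty {Ω : Type*} (X : Word → Ω → (Fin d → ℝ)) (μm : Measure (Fin d → ℝ))
    (f : ℕ → ℕ → (Fin d → ℝ) → ℝ) (n : ℕ) (ω : Ω) : ℝ :=
  (Real.sqrt (2 ^ n))⁻¹ * ∑ ℓ ∈ Finset.range (n + 1), MA X (gen (n - ℓ)) (tilde μm (f n ℓ)) ω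

/-- Conditions on the auxiliary sequence `p_n`. -/
def PCond (p : ℕ → ℕ) (b : ℕ → ℝ) : Prop :=
  Monotone p ∧ (∀ n, 1 ≤ p n) ∧ (∀ n, 1 ≤ n → p n ≤ n) ∧
    Tendsto (fun n => (p n : ℝ) ^ 3 * b n ^ 2 / 2 ^ (n - p n : ℕ)) atTop (nhds 0)

/-- `N_{n,i}(𝔣_n)` for `i ∈ G_{n-p_n}`. -/
def Nni {Ω : Type*} (X : Word → Ω → (Fin d → ℝ)) (μm : Measure (Fin d → ℝ))
    (f : ℕ → ℕ → (Fin d → ℝ) → ℝ) (p : ℕ → ℕ) (n : ℕ) (i : Word) (ω : Ω) : ℝ :=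
  (Real.sqrt (2 ^ n))⁻¹ * ∑ ℓ ∈ Finset.range (p n + 1),
    ∑ j ∈ gen (p n - ℓ), tilde μm (f n ℓ) (X (i ++ j) ω)

/-- The martingale increment `Δ_{n,i}(𝔣_n)`. -/
def Dni {Ω : Type*} [MeasurableSpace Ω] (Pr : Measure Ω) (X : Word → Ω → (Fin d → ℝ))
    (μm : Measure (Fin d → ℝ)) (f : ℕ → ℕ → (Fin d → ℝ) → ℝ) (p : ℕ → ℕ)
    (n : ℕ) (i : Word) (ω : Ω) : ℝ :=
  Nni X μm f p n i ω - (Pr[Nni X μm f p n i | Fsig X i]) ω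

/-- A measurable function that is bounded in absolute value. -/
def BddMeas {α : Type*} [MeasurableSpace α] (f : α → ℝ) : Prop :=
  Measurable f ∧ ∃ C, ∀ y, |f y| ≤ C

namespace BddMeas

variable {α β : Type*} [MeasurableSpace α] [MeasurableSpace β] {f g : α → ℝ}

lemma const (c : ℝ) : BddMeas fun _ : α => c :=
  ⟨measurable_const, |c|, fun _ => le_rfl⟩

lemma add (hf : BddMeas f) (hg : BddMeas g) : BddMeas fun y => f y + g y := by
  obtain ⟨hf, C, hC⟩ := hf
  obtain ⟨hg, D, hD⟩ := hg
  exact ⟨hf.add hg, C + D, fun y => (abs_add_le _ _).trans (add_le_add (hC y) (hD y))⟩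

lemma mul (hf : BddMeas f) (hg : BddMeas g) : BddMeas fun y => f y * g y := by
  obtain ⟨hf, C, hC⟩ := hf
  obtain ⟨hg, D, hD⟩ := hg
  refine ⟨hf.mul hg, C * D, fun y => ?_⟩
  rw [abs_mul]
  exact mul_le_mul (hC y) (hD y) (abs_nonneg _) ((abs_nonneg _).trans (hC y))

lemma sq (hf : BddMeas f) : BddMeas fun y => f y ^ 2 := by
  simpa only [pow_two] using hf.mul hf

lemma comp (hf : BddMeas f) {φ : β → α} (hφ : Measurable φ) : BddMeas fun y => f (φ y) :=
  ⟨hf.1.comp hφ, hf.2.imp fun _ hC y => hC (φ y)⟩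

lemma sum {ι : Type*} (s : Finset ι) {u : ι → α → ℝ} (hu : ∀ i, BddMeas (u i)) :
    BddMeas fun y => ∑ i ∈ s, u i y := by
  classical
  induction s using Finset.induction_on with
  | empty => simpa using const 0
  | insert a s ha ih => simpa only [Finset.sum_insert ha] using (hu a).add ih

lemma integrable (hf : BddMeas f) (μ : Measure α) [IsFiniteMeasure μ] : Integrable f μ := by
  obtain ⟨hf, C, hC⟩ := hf
  exact Integrable.of_bound hf.aestronglyMeasurable C (ae_of_all _ hC)

lemma integral_kernel {h : β → ℝ} (hh : BddMeas h) (κ : Kernel α β) [IsMarkovKernel κ] :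
    BddMeas fun a => ∫ b, h b ∂(κ a) := by
  obtain ⟨hm, C, hC⟩ := hh
  refine ⟨hm.stronglyMeasurable.integral_kernel.measurable, C, fun a => ?_⟩
  simpa using norm_integral_le_of_norm_le_const (μ := κ a) (f := h) (ae_of_all _ hC)

end BddMeas

section Kernels

variable {P : Kernel (Fin d → ℝ) ((Fin d → ℝ) × (Fin d → ℝ))} {f : (Fin d → ℝ) → ℝ}

lemma pop_fst_add_snd (y : Fin d → ℝ) : Pop P (fun p => f p.1 + f p.2) y = 2 * Qop P f y := by
  simp only [Pop, Qop]
  ring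

lemma BddMeas.fst_add_snd (hf : BddMeas f) :
    BddMeas fun p : (Fin d → ℝ) × (Fin d → ℝ) => f p.1 + f p.2 :=
  (hf.comp measurable_fst).add (hf.comp measurable_snd)

lemma BddMeas.fst_mul_snd (hf : BddMeas f) :
    BddMeas fun p : (Fin d → ℝ) × (Fin d → ℝ) => f p.1 * f p.2 :=
  (hf.comp measurable_fst).mul (hf.comp measurable_snd)

variable [IsMarkovKernel P]

lemma BddMeas.pop {h : (Fin d → ℝ) × (Fin d → ℝ) → ℝ} (hh : BddMeas h) :
    BddMeas (Pop P h) :=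
  hh.integral_kernel P

lemma BddMeas.qop (hf : BddMeas f) : BddMeas (Qop P f) :=
  (hf.fst_add_snd.integral_kernel P).mul (.const 2⁻¹)

lemma pop_fst_add_snd_sq (hf : BddMeas f) (y : Fin d → ℝ) :
    Pop P (fun p => (f p.1 + f p.2) * (f p.1 + f p.2)) y =
      2 * Qop P (fun z => f z ^ 2) y + 2 * Pop P (fun p => f p.1 * f p.2) y := by
  rw [← pop_fst_add_snd]
  simp only [Pop]
  rw [← integral_const_mul, ← integral_add (hf.sq.fst_add_snd.integrable _)
    ((hf.fst_mul_snd.integrable _).const_mul _)]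
  congr 1 with p
  ring

end Kernels

lemma sum_gen_succ {M : Type*} [AddCommMonoid M] (n : ℕ) (φ : Word → M) :
    ∑ i ∈ gen (n + 1), φ i = ∑ i ∈ gen n, (φ (i ++ [false]) + φ (i ++ [true])) := by
  unfold gen
  rw [Finset.sum_image fun _ _ _ _ h => List.ofFn_injective h,
    Finset.sum_image fun _ _ _ _ h => List.ofFn_injective h,
    ← (Fin.snocEquiv fun _ : Fin (n + 1) => Bool).sum_comp, Fintype.sum_prod_type,
    Fintype.sum_bool, Finset.sum_add_distrib, add_comm]
  simp [Fin.snocEquiv, List.ofFn_succ', List.concat_eq_append, -List.ofFn_succ]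

lemma MA_gen_succ {Ω : Type*} (X : Word → Ω → (Fin d → ℝ)) (f : (Fin d → ℝ) → ℝ) (n : ℕ) (ω : Ω) :
    MA X (gen (n + 1)) f ω =
      ∑ i ∈ gen n, (f (X (i ++ [false]) ω) + f (X (i ++ [true]) ω)) :=
  sum_gen_succ n fun i => f (X i ω)

namespace IsBMC

variable {Ω : Type*} [MeasurableSpace Ω] {Pr : Measure Ω}
  {X : Word → Ω → (Fin d → ℝ)} {ν : Measure (Fin d → ℝ)}
  {P : Kernel (Fin d → ℝ) ((Fin d → ℝ) × (Fin d → ℝ))} {f : (Fin d → ℝ) → ℝ}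

lemma bddMeas_children (hX : IsBMC Pr X ν P) (hf : BddMeas f) (i : Word) :
    BddMeas fun ω => f (X (i ++ [false]) ω) + f (X (i ++ [true]) ω) :=
  (hf.comp (hX.meas _)).add (hf.comp (hX.meas _))

lemma integral_MA_gen_zero {x : Fin d → ℝ} (hX : IsBMC Pr X (.dirac x) P) (hf : BddMeas f) :
    ∫ ω, MA X (gen 0) f ω ∂Pr = f x := by
  have h := integral_map (hX.meas []).aemeasurable
    (hf.1.aestronglyMeasurable (μ := Pr.map (X [])))
  rw [hX.init, integral_dirac' _ _ hf.1.stronglyMeasurable] at h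
  simp [MA, gen, h]

lemma integral_prod_children [IsFiniteMeasure Pr] (hX : IsBMC Pr X ν P) (k : ℕ)
    {g : Word → (Fin d → ℝ) × (Fin d → ℝ) → ℝ} (hg : ∀ i, BddMeas (g i)) :
    ∫ ω, ∏ i ∈ gen k, g i (X (i ++ [false]) ω, X (i ++ [true]) ω) ∂Pr =
      ∫ ω, ∏ i ∈ gen k, Pop P (g i) (X i ω) ∂Pr := by
  have hle : sigmaUpTo X k ≤ ‹MeasurableSpace Ω› :=
    iSup₂_le fun j _ => (hX.meas j).comap_le
  rw [← integral_condExp hle]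
  exact integral_congr_ae (hX.branching k (fun i _ y z => g i (y, z))
    (fun i => (hg i).1.comp measurable_snd) fun i => (hg i).2.imp fun _ hC _ y z => hC (y, z))

variable [IsProbabilityMeasure Pr] [IsMarkovKernel P]

lemma integral_children (hX : IsBMC Pr X ν P) {k : ℕ} {a : Word} (ha : a ∈ gen k)
    {h : (Fin d → ℝ) × (Fin d → ℝ) → ℝ} (hh : BddMeas h) :
    ∫ ω, h (X (a ++ [false]) ω, X (a ++ [true]) ω) ∂Pr = ∫ ω, Pop P h (X a ω) ∂Pr := by
  have key := hX.integral_prod_children k (g := fun i => if i = a then h else fun _ => 1)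
    fun i => by split_ifs <;> [exact hh; exact .const 1]
  have hone : Pop P (fun _ => 1) = fun _ => 1 := by ext; simp [Pop]
  simpa [apply_ite (Pop P), ite_apply, hone, Finset.prod_ite_eq', ha] using key

lemma integral_children_mul_children (hX : IsBMC Pr X ν P) {k : ℕ} {a b : Word}
    (ha : a ∈ gen k) (hb : b ∈ gen k) (hab : a ≠ b)
    {h : (Fin d → ℝ) × (Fin d → ℝ) → ℝ} (hh : BddMeas h) :
    ∫ ω, h (X (a ++ [false]) ω, X (a ++ [true]) ω) *
        h (X (b ++ [false]) ω, X (b ++ [true]) ω) ∂Pr =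
      ∫ ω, Pop P h (X a ω) * Pop P h (X b ω) ∂Pr := by
  have key := hX.integral_prod_children k
    (g := fun i => if i ∈ ({a, b} : Finset Word) then h else fun _ => 1)
    fun i => by split_ifs <;> [exact hh; exact .const 1]
  have hone : Pop P (fun _ => 1) = fun _ => 1 := by ext; simp [Pop]
  have hsub : gen k ∩ {a, b} = {a, b} := Finset.inter_eq_right.2 (by
    simp [Finset.insert_subset_iff, ha, hb])
  simpa only [apply_ite (Pop P), ite_apply, hone, Finset.prod_ite_mem, hsub,
    Finset.prod_pair hab] using key

lemma integral_MA_gen_succ (hX : IsBMC Pr X ν P) (n : ℕ) (hf : BddMeas f) :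
    ∫ ω, MA X (gen (n + 1)) f ω ∂Pr = 2 * ∫ ω, MA X (gen n) (Qop P f) ω ∂Pr := by
  simp only [MA_gen_succ]
  rw [integral_finsetSum _ fun i _ => (hX.bddMeas_children hf i).integrable _]
  simp only [MA]
  rw [integral_finsetSum _ fun i _ => (hf.qop.comp (hX.meas i)).integrable _, Finset.mul_sum]
  refine Finset.sum_congr rfl fun i hi => ?_
  rw [hX.integral_children hi hf.fst_add_snd, ← integral_const_mul]
  simp only [pop_fst_add_snd]

lemma integral_MA_gen {x : Fin d → ℝ} (hX : IsBMC Pr X (.dirac x) P) (hf : BddMeas f) (n : ℕ) :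
    ∫ ω, MA X (gen n) f ω ∂Pr = 2 ^ n * (Qop P)^[n] f x := by
  induction n generalizing f with
  | zero => simpa using hX.integral_MA_gen_zero hf
  | succ n ih =>
    rw [hX.integral_MA_gen_succ n hf, ih hf.qop, Function.iterate_succ_apply]
    ring

lemma integral_MA_gen_succ_sq (hX : IsBMC Pr X ν P) (n : ℕ) (hf : BddMeas f) :
    ∫ ω, MA X (gen (n + 1)) f ω ^ 2 ∂Pr =
      2 * ∫ ω, MA X (gen n) (Qop P fun y => f y ^ 2) ω ∂Pr +
      2 * ∫ ω, MA X (gen n) (Pop P fun p => f p.1 * f p.2) ω ∂Pr +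
      4 * (∫ ω, MA X (gen n) (Qop P f) ω ^ 2 ∂Pr -
        ∫ ω, MA X (gen n) (fun y => Qop P f y ^ 2) ω ∂Pr) := by
  have hc := hX.bddMeas_children hf
  have hq := fun i => (hf.qop (P := P)).comp (hX.meas i)
  have hq2 := fun i => (hf.qop (P := P)).sq.comp (hX.meas i)
  have hs := fun i => (hf.sq.qop (P := P)).comp (hX.meas i)
  have hp := fun i => (hf.fst_mul_snd.pop (P := P)).comp (hX.meas i)
  have hcross : ∀ i ∈ gen n, ∀ j ∈ gen n,
      ∫ ω, (f (X (i ++ [false]) ω) + f (X (i ++ [true]) ω)) *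
          (f (X (j ++ [false]) ω) + f (X (j ++ [true]) ω)) ∂Pr =
        4 * ∫ ω, Qop P f (X i ω) * Qop P f (X j ω) ∂Pr +
        if i = j then
          2 * ∫ ω, Qop P (fun y => f y ^ 2) (X i ω) ∂Pr +
          2 * ∫ ω, Pop P (fun p => f p.1 * f p.2) (X i ω) ∂Pr -
          4 * ∫ ω, Qop P f (X i ω) ^ 2 ∂Pr
        else 0 := by
    intro i hi j hj
    split_ifs with hij
    · subst hij
      rw [hX.integral_children hi (hf.fst_add_snd.mul hf.fst_add_snd)]
      simp only [pop_fst_add_snd_sq hf]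
      simp only [← pow_two]
      rw [integral_add (((hs i).integrable _).const_mul _) (((hp i).integrable _).const_mul _),
        integral_const_mul, integral_const_mul]
      ring
    · rw [hX.integral_children_mul_children hi hj hij hf.fst_add_snd, add_zero,
        ← integral_const_mul]
      simp only [pop_fst_add_snd]
      congr 1 with ω
      ring
  simp only [MA_gen_succ]
  simp only [MA, pow_two (Finset.sum _ _), Finset.sum_mul_sum]
  rw [integral_finsetSum _ fun i _ => (BddMeas.sum _ fun j => (hc i).mul (hc j)).integrable _,
    integral_finsetSum _ fun i _ => (BddMeas.sum _ fun j => (hq i).mul (hq j)).integrable _,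
    integral_finsetSum _ fun i _ => (hq2 i).integrable _,
    integral_finsetSum _ fun i _ => (hs i).integrable _,
    integral_finsetSum _ fun i _ => (hp i).integrable _]
  have hl : ∀ i ∈ gen n, _ := fun i hi =>
    (integral_finsetSum (gen n) fun j _ => ((hc i).mul (hc j)).integrable Pr).trans
      (Finset.sum_congr rfl fun j hj => hcross i hi j hj)
  have hr : ∀ i ∈ gen n, _ := fun i _ =>
    integral_finsetSum (gen n) fun j _ => ((hq i).mul (hq j)).integrable Pr
  rw [Finset.sum_congr rfl hl, Finset.sum_congr rfl hr]
  simp only [Finset.sum_add_distrib, Finset.sum_ite_eq, Finset.sum_ite_mem, Finset.inter_self,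
    Finset.sum_sub_distrib, ← Finset.mul_sum]
  ring

lemma integral_MA_gen_sq {x : Fin d → ℝ} (hX : IsBMC Pr X (.dirac x) P) (hf : BddMeas f)
    (n : ℕ) :
    ∫ ω, MA X (gen n) f ω ^ 2 ∂Pr =
      2 ^ n * (Qop P)^[n] (fun y => f y ^ 2) x +
        ∑ k ∈ Finset.range n, 2 ^ (n + k) *
          (Qop P)^[n - k - 1]
            (Pop P (fun q => (Qop P)^[k] f q.1 * (Qop P)^[k] f q.2)) x := by
  induction n generalizing f with
  | zero => simpa [MA, gen] using hX.integral_MA_gen_zero hf.sq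
  | succ n ih =>
    rw [hX.integral_MA_gen_succ_sq n hf, ih hf.qop, hX.integral_MA_gen hf.qop.sq,
      hX.integral_MA_gen hf.sq.qop, hX.integral_MA_gen hf.fst_mul_snd.pop,
      Finset.sum_range_succ', add_sub_cancel_left, Finset.mul_sum]
    simp only [Function.iterate_succ_apply, Function.iterate_zero, id_eq, Nat.sub_zero,
      Nat.add_sub_add_right, Nat.add_sub_cancel, add_zero]
    have hpow : ∀ k : ℕ, (2 : ℝ) ^ (n + 1 + (k + 1)) = 4 * 2 ^ (n + k) := fun k => by ring
    simp only [hpow, mul_assoc]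
    ring

end IsBMC

/-- Lemma 6.2 (eq. (6.1)–(6.2)): many-to-one formulas for the first two moments. -/
theorem many_to_one_first_two_moments
    {d : ℕ} (hd : 1 ≤ d)
    {Ω : Type*} [MeasurableSpace Ω] (Pr : Measure Ω) [IsProbabilityMeasure Pr]
    (X : Word → Ω → (Fin d → ℝ))
    (P : Kernel (Fin d → ℝ) ((Fin d → ℝ) × (Fin d → ℝ))) [IsMarkovKernel P]
    (x : Fin d → ℝ) (hBMC : IsBMC Pr X (Measure.dirac x) P)
    (f : (Fin d → ℝ) → ℝ) (hfm : Measurable f) (hfb : ∃ C, ∀ y, |f y| ≤ C) (n : ℕ) :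
    (∫ ω, MA X (gen n) f ω ∂Pr) = 2 ^ n * (Qop P)^[n] f x ∧
    (∫ ω, (MA X (gen n) f ω) ^ 2 ∂Pr) =
      2 ^ n * (Qop P)^[n] (fun y => f y ^ 2) x +
        ∑ k ∈ Finset.range n, 2 ^ (n + k) *
          (Qop P)^[n - k - 1]
            (Pop P (fun q => (Qop P)^[k] f q.1 * (Qop P)^[k] f q.2)) x := by
  exact ⟨hBMC.integral_MA_gen ⟨hfm, hfb⟩ n, hBMC.integral_MA_gen_sq ⟨hfm, hfb⟩ n⟩

end BMC
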